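/- arXiv:2407.12546 — 3 statements merged into one kernel-verified Lean document; each statement's English description precedes it below -/
import Mathlib

section
/- Let n ≥ 2, p ≥ 1, b ≥ 1, and let n₁,…,n_{p+1} be positive integers with n₁+⋯+n_{p+1} = n. If Y ∈ ℝ^{n×b} satisfies QY = Y for every Q ∈ S(O_{n₁}×⋯×O_{n_{p+1}}), then Y = 0. Equivalently, for every nonzero Y ∈ ℝ^{n×b}, the subgroup S(O_{n₁}×⋯×O_{n_{p+1}}) is not contained in {Q ∈ SO_n(ℝ) : QY = Y}. -/
open Matrix Topology

/-- `SOn n` is the set of real `n × n` special orthogonal matrices. -/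
def SOn (n : ℕ) : Set (Matrix (Fin n) (Fin n) ℝ) :=
  {Q | Qᵀ * Q = 1 ∧ Q.det = 1}

/-- The diagonal matrix with entries `-1` at two distinct positions and `1` elsewhere is special
orthogonal. -/
theorem diagonal_neg_pair_mem_SOn {n : ℕ} {i k : Fin n} (hik : i ≠ k) :
    diagonal (fun j => if j = i ∨ j = k then (-1 : ℝ) else 1) ∈ SOn n := by
  constructor
  · rw [diagonal_transpose, diagonal_mul_diagonal, ← diagonal_one]
    congr 1
    funext j
    split_ifs <;> norm_num
  · have hfilter : Finset.univ.filter (fun j => j = i ∨ j = k) = {i, k} := by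
      ext j
      simp
    rw [det_diagonal, Finset.prod_ite, hfilter]
    simp [Finset.card_pair hik]

/-- Let `n ≥ 2`, `p ≥ 1`, `b ≥ 1`, and let `n₁, …, n_{p+1}` be positive
integers summing to `n` (encoded by the monotone block function `blk` with fibers of
cardinality `nn i`).  If `Y ∈ ℝ^{n×b}` satisfies `Q Y = Y` for every
`Q ∈ S(O_{n₁} × ⋯ × O_{n_{p+1}})` (the block-diagonal special orthogonal matrices), then
`Y = 0`.  Equivalently, for nonzero `Y`, `S(O_{n₁} × ⋯ × O_{n_{p+1}})` is not contained in
`{Q ∈ SO_n(ℝ) : Q Y = Y}`. -/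
theorem matrix_fixed_by_blockOrthogonal_eq_zero
    (n p b : ℕ) (hn : 2 ≤ n) (hp : 1 ≤ p) (hb : 1 ≤ b)
    (nn : Fin (p + 1) → ℕ) (hpos : ∀ i, 0 < nn i) (hsum : ∑ i, nn i = n)
    (blk : Fin n → Fin (p + 1)) (hmono : Monotone blk)
    (hfib : ∀ i, (Finset.univ.filter fun j => blk j = i).card = nn i)
    (Y : Matrix (Fin n) (Fin b) ℝ)
    (hfix : ∀ Q ∈ SOn n, (∀ i j, blk i ≠ blk j → Q i j = 0) → Q * Y = Y) :
    Y = 0 := by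
  ext i j
  have : Nontrivial (Fin n) := Fin.nontrivial_iff_two_le.mpr hn
  obtain ⟨k, hk⟩ := exists_ne i
  have hY := hfix _ (diagonal_neg_pair_mem_SOn hk.symm)
    fun a c hac => diagonal_apply_ne _ fun h => hac (congrArg blk h)
  have hij := congrFun (congrFun hY i) j
  rw [diagonal_mul, if_pos (Or.inl rfl)] at hij
  rw [Matrix.zero_apply]
  linarith
end

section
/- Let n = 3 or n ≥ 5. The conjugation action of SO_n(ℝ) on Alt²(ℝⁿ), Q·X = QXQᵀ, is irreducible: the only linear subspaces U ⊆ Alt²(ℝⁿ) satisfying QUQᵀ ⊆ U for all Q ∈ SO_n(ℝ) are U = 0 and U = Alt²(ℝⁿ). -/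
open Matrix Topology

/-- `Alt²(ℝⁿ)`: the space of real skew-symmetric `n × n` matrices. -/
def altTwo (n : ℕ) : Submodule ℝ (Matrix (Fin n) (Fin n) ℝ) where
  carrier := {X | Xᵀ = -X}
  add_mem' := fun hX hY => by
    simp only [Set.mem_setOf_eq] at *
    rw [Matrix.transpose_add, hX, hY, neg_add]
  zero_mem' := by simp
  smul_mem' := fun c X hX => by
    simp only [Set.mem_setOf_eq] at *
    rw [Matrix.transpose_smul, hX, smul_neg]

/-- The sign vector that is `-1` exactly at the positions `p` and `r` (trivial if `p = r`). -/
def flipPair {n : ℕ} (p r : Fin n) (i : Fin n) : ℝ :=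
  (if i = p then -1 else 1) * (if i = r then -1 else 1)

theorem diagonal_flipPair_mem_SOn {n : ℕ} (p r : Fin n) :
    diagonal (flipPair p r) ∈ SOn n := by
  refine ⟨?_, ?_⟩
  · rw [diagonal_transpose, diagonal_mul_diagonal, ← diagonal_one]
    congr 1
    funext i
    simp only [flipPair]
    split_ifs <;> norm_num
  · rw [det_diagonal]
    simp only [flipPair]
    rw [Finset.prod_mul_distrib]
    simp

/-- The elementary skew-symmetric matrix `E_pq - E_qp`. -/
def skewSingle {n : ℕ} (p q : Fin n) : Matrix (Fin n) (Fin n) ℝ :=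
  single p q 1 - single q p 1

section Invariant

variable {n : ℕ} {U : Submodule ℝ (Matrix (Fin n) (Fin n) ℝ)}

/-- An invariant subspace is stable under the weighting `X i j ↦ (1 + c dᵢ dⱼ) X i j`,
where `d` flips two signs. -/
theorem flipPair_weight_mem (hUinv : ∀ Q ∈ SOn n, ∀ X ∈ U, Q * X * Qᵀ ∈ U)
    (c : ℝ) (p r : Fin n) {X : Matrix (Fin n) (Fin n) ℝ} (hX : X ∈ U) :
    of (fun i j => (1 + c * (flipPair p r i * flipPair p r j)) * X i j) ∈ U := by
  convert U.add_mem hX (U.smul_mem c (hUinv _ (diagonal_flipPair_mem_SOn p r) X hX)) using 1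
  ext i j
  simp only [of_apply, Matrix.add_apply, Matrix.smul_apply, smul_eq_mul,
    diagonal_transpose, mul_diagonal, diagonal_mul]
  ring

theorem skewSingle_mem_of_smul_mem {p q : Fin n} {c : ℝ} (hc : c ≠ 0)
    (h : c • skewSingle p q ∈ U) : skewSingle p q ∈ U :=
  (U.smul_mem_iff hc).1 h

/-- If a skew-symmetric matrix in an invariant subspace has a nonzero `(p, q)` entry, the subspace
contains `E_pq - E_qp`. -/
theorem skewSingle_mem_of_apply_ne_zero (hn : n = 3 ∨ 5 ≤ n)
    (hUinv : ∀ Q ∈ SOn n, ∀ X ∈ U, Q * X * Qᵀ ∈ U)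
    {X : Matrix (Fin n) (Fin n) ℝ} (hX : X ∈ U) (hskew : X ∈ altTwo n) {p q : Fin n}
    (hpq : X p q ≠ 0) : skewSingle p q ∈ U := by
  have hs (i j : Fin n) : X j i = -X i j := congrFun (congrFun hskew i) j
  have hd (i : Fin n) : X i i = 0 := by linarith [hs i i]
  have hne : p ≠ q := by
    rintro rfl
    exact hpq (hd p)
  have hY := flipPair_weight_mem hUinv 1 p q hX
  obtain rfl | hn := hn
  · refine skewSingle_mem_of_smul_mem (mul_ne_zero two_ne_zero hpq) ?_
    convert hY using 1
    ext i j
    have := hs p q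
    simp only [skewSingle, single_apply, flipPair, Matrix.smul_apply, Matrix.sub_apply,
      of_apply, smul_eq_mul]
    by_cases hip : i = p <;> by_cases hiq : i = q <;> by_cases hjp : j = p <;>
      by_cases hjq : j = q <;> grind
  · have hcard : 2 < (Finset.univ \ {p, q} : Finset (Fin n)).card := by
      rw [Finset.card_sdiff_of_subset (Finset.subset_univ _), Finset.card_pair hne,
        Finset.card_univ, Fintype.card_fin]
      omega
    obtain ⟨r, hr, s, hs', t, ht, hrs, hrt, hst⟩ := Finset.two_lt_card.1 hcard
    simp only [Finset.mem_sdiff, Finset.mem_univ, true_and, Finset.mem_insert,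
      Finset.mem_singleton, not_or] at hr hs' ht
    have hZ := flipPair_weight_mem hUinv (-1) p t
      (flipPair_weight_mem hUinv (-1) p s (flipPair_weight_mem hUinv (-1) p r hY))
    refine skewSingle_mem_of_smul_mem (mul_ne_zero (by norm_num : (16 : ℝ) ≠ 0) hpq) ?_
    convert hZ using 1
    ext i j
    have := hs p q
    simp only [skewSingle, single_apply, flipPair, Matrix.smul_apply, Matrix.sub_apply,
      of_apply, smul_eq_mul]
    by_cases hip : i = p <;> by_cases hiq : i = q <;> by_cases hjp : j = p <;>
      by_cases hjq : j = q <;> grind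

/-- `SO_n` moves `E_pq - E_qp` to a nonzero multiple of any other `E_ab - E_ba`: use a permutation
matrix with the sign of one column corrected to make the determinant `1`. -/
theorem exists_SOn_conj_skewSingle {p q a b : Fin n} (hpq : p ≠ q) (hab : a ≠ b) :
    ∃ Q ∈ SOn n, ∃ c : ℝ, c ≠ 0 ∧ Q * skewSingle p q * Qᵀ = c • skewSingle a b := by
  let σ : Equiv.Perm (Fin n) := Equiv.swap (Equiv.swap p a q) b * Equiv.swap p a
  have hσp : σ p = a := by
    simp only [σ, Equiv.Perm.mul_apply, Equiv.swap_apply_left]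
    refine Equiv.swap_apply_of_ne_of_ne (fun h => hpq ?_) hab
    exact (Equiv.swap p a).injective (by rw [Equiv.swap_apply_left, ← h])
  have hσq : σ q = b := by simp [σ]
  let ε : ℝ := ((Equiv.Perm.sign σ : ℤ) : ℝ)
  have hε : ε * ε = 1 := by
    simp only [ε]
    exact_mod_cast Int.units_coe_mul_self (Equiv.Perm.sign σ)
  let d : Fin n → ℝ := fun i => if i = p then ε else 1
  have hdd : (fun i => d i * d i) = fun _ => 1 := by
    funext i
    simp only [d]
    split_ifs <;> simp [hε]
  refine ⟨(diagonal d).submatrix σ.symm id, ⟨?_, ?_⟩, ε, fun h => by simp [h] at hε, ?_⟩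
  · rw [transpose_submatrix, submatrix_mul_equiv, diagonal_transpose, diagonal_mul_diagonal, hdd,
      diagonal_one, submatrix_id_id]
  · have h := det_permute σ.symm (diagonal d)
    rw [h, det_diagonal, Equiv.Perm.sign_symm]
    simpa [d] using hε
  · have : (diagonal d).submatrix σ.symm id * skewSingle p q *
        ((diagonal d).submatrix σ.symm id)ᵀ =
        (diagonal d * skewSingle p q * diagonal d).submatrix σ.symm σ.symm := by
      ext i j
      simp [mul_apply, diagonal_apply]
    rw [this]
    ext i j
    have h (x y : Fin n) : σ.symm x = y ↔ x = σ y := σ.symm_apply_eq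
    simp only [submatrix_apply, mul_diagonal, diagonal_mul, skewSingle, Matrix.smul_apply,
      Matrix.sub_apply, single_apply, smul_eq_mul, d, eq_comm (b := σ.symm _), h, hσp, hσq]
    grind

end Invariant

theorem eq_half_sum_skewSingle {n : ℕ} {X : Matrix (Fin n) (Fin n) ℝ} (hX : X ∈ altTwo n) :
    X = (1 / 2 : ℝ) • ∑ i, ∑ j, X i j • skewSingle i j := by
  have hT : ∑ i, ∑ j, single j i (X i j) = Xᵀ := by
    rw [Finset.sum_comm]
    exact (matrix_eq_sum_single Xᵀ).symm
  have hX' : Xᵀ = -X := hX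
  simp only [skewSingle, smul_sub, smul_single, smul_eq_mul, mul_one, Finset.sum_sub_distrib, hT,
    ← matrix_eq_sum_single X, hX']
  module

/-- Let `n = 3` or `n ≥ 5`.  The conjugation action `Q · X = Q X Qᵀ` of
`SO_n(ℝ)` on `Alt²(ℝⁿ)` is irreducible: the only linear subspaces `U ⊆ Alt²(ℝⁿ)` with
`Q U Qᵀ ⊆ U` for all `Q ∈ SO_n(ℝ)` are `0` and `Alt²(ℝⁿ)`. -/
theorem conjugation_on_altTwo_irreducible
    (n : ℕ) (hn : n = 3 ∨ 5 ≤ n)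
    (U : Submodule ℝ (Matrix (Fin n) (Fin n) ℝ)) (hUle : U ≤ altTwo n)
    (hUinv : ∀ Q ∈ SOn n, ∀ X ∈ U, Q * X * Qᵀ ∈ U) :
    U = ⊥ ∨ U = altTwo n := by
  refine or_iff_not_imp_left.2 fun hU => le_antisymm hUle fun Y hY => ?_
  obtain ⟨X, hX, hX0⟩ := U.ne_bot_iff.1 hU
  obtain ⟨p, q, hpq⟩ : ∃ p q, X p q ≠ 0 := by
    by_contra! h
    exact hX0 (Matrix.ext h)
  have hmem := skewSingle_mem_of_apply_ne_zero hn hUinv hX (hUle hX) hpq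
  have hne : p ≠ q := by
    rintro rfl
    have : X p p = -X p p := congrFun (congrFun (hUle hX) p) p
    exact hpq (by linarith)
  rw [eq_half_sum_skewSingle hY]
  refine U.smul_mem _ (U.sum_mem fun a _ => U.sum_mem fun b _ => U.smul_mem _ ?_)
  obtain rfl | hab := eq_or_ne a b
  · simp [skewSingle]
  · obtain ⟨Q, hQ, c, hc, h⟩ := exists_SOn_conj_skewSingle hne hab
    exact skewSingle_mem_of_smul_mem hc (h ▸ hUinv Q hQ _ hmem)
end

section
/- Let n ≥ 3, m = ⌊n/2⌋, and define f_n on {x ∈ ℝ^m : x₁ ≥ ⋯ ≥ x_m ≥ 0} by f_n(x) = ∏_{1≤i<j≤m} (x_i−x_j−i+j)/(j−i) · ∏_{1≤i≤j≤m} (x_i+x_j+n−i−j)/(n−i−j) if n = 2m+1, and f_n(x) = ∏_{1≤i<j≤m} [(x_i−x_j−i+j)/(j−i)]·[(x_i+x_j+n−i−j)/(n−i−j)] if n = 2m. Suppose x₁ ≥ ⋯ ≥ x_k > 0 = x_{k+1} = ⋯ = x_m for some 1 ≤ k ≤ m, let 0 < δ < x_k, and set y = (x₁−δ,…,x_k−δ,0,…,0)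 ∈ ℝ^m. Then f_n(y) < f_n(x). -/
/-- The Weyl dimension formula `f_n` for `SO_n`, defined on `x ∈ ℝ^m`, `m = ⌊n/2⌋`
(indices `i, j` below run over `1, …, m`, realized in Lean by `0`-based indices shifted
by one):
* if `n = 2m + 1` (odd), `f_n(x) = ∏_{i<j} (x_i−x_j−i+j)/(j−i) · ∏_{i≤j}
  (x_i+x_j+n−i−j)/(n−i−j)`;
* if `n = 2m` (even), `f_n(x) = ∏_{i<j} [(x_i−x_j−i+j)/(j−i)]·[(x_i+x_j+n−i−j)/(n−i−j)]`. -/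
noncomputable def weylSO (n : ℕ) (x : Fin (n / 2) → ℝ) : ℝ :=
  if n % 2 = 1 then
    (∏ i : Fin (n / 2), ∏ j : Fin (n / 2), if i < j then
        (x i - x j - (((i : ℕ) : ℝ) + 1) + (((j : ℕ) : ℝ) + 1)) /
          (((j : ℕ) : ℝ) - ((i : ℕ) : ℝ))
      else 1) *
    (∏ i : Fin (n / 2), ∏ j : Fin (n / 2), if i ≤ j then
        (x i + x j + (n : ℝ) - (((i : ℕ) : ℝ) + 1) - (((j : ℕ) : ℝ) + 1)) /
          ((n : ℝ) - (((i : ℕ) : ℝ) + 1) - (((j : ℕ) : ℝ) + 1))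
      else 1)
  else
    ∏ i : Fin (n / 2), ∏ j : Fin (n / 2), if i < j then
        ((x i - x j - (((i : ℕ) : ℝ) + 1) + (((j : ℕ) : ℝ) + 1)) /
          (((j : ℕ) : ℝ) - ((i : ℕ) : ℝ))) *
        ((x i + x j + (n : ℝ) - (((i : ℕ) : ℝ) + 1) - (((j : ℕ) : ℝ) + 1)) /
          ((n : ℝ) - (((i : ℕ) : ℝ) + 1) - (((j : ℕ) : ℝ) + 1)))
      else 1

/-- Strict monotonicity of finite double products of positive reals. -/
theorem prod_prod_lt_prod_prod {ι κ : Type*} [Fintype ι] [Fintype κ] {F G : ι → κ → ℝ}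
    (hF : ∀ i j, 0 < F i j) (hFG : ∀ i j, F i j ≤ G i j) (hlt : ∃ i j, F i j < G i j) :
    ∏ i, ∏ j, F i j < ∏ i, ∏ j, G i j := by
  obtain ⟨i₀, j₀, h⟩ := hlt
  refine Finset.prod_lt_prod (fun i _ => Finset.prod_pos fun j _ => hF i j)
    (fun i _ => Finset.prod_le_prod (fun j _ => (hF i j).le) fun j _ => hFG i j)
    ⟨i₀, Finset.mem_univ _, ?_⟩
  exact Finset.prod_lt_prod (fun j _ => hF i₀ j) (fun j _ => hFG i₀ j)
    ⟨j₀, Finset.mem_univ _, h⟩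

/-- Let `n ≥ 3`, `m = ⌊n/2⌋`, and let `f_n` be the Weyl dimension formula
above, on the domain `{x : x₁ ≥ ⋯ ≥ x_m ≥ 0}`.  Suppose `x₁ ≥ ⋯ ≥ x_k > 0 = x_{k+1} = ⋯ =
x_m` for some `1 ≤ k ≤ m`, let `0 < δ < x_k`, and set `y = (x₁−δ, …, x_k−δ, 0, …, 0)`.
Then `f_n(y) < f_n(x)`. -/
theorem weyl_dim_strict_mono_shift
    (n : ℕ) (hn : 3 ≤ n) (x : Fin (n / 2) → ℝ)
    (hsort : ∀ i j : Fin (n / 2), i ≤ j → x j ≤ x i)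
    (k : ℕ) (hk1 : 1 ≤ k) (hkm : k ≤ n / 2)
    (hpos : ∀ i : Fin (n / 2), (i : ℕ) < k → 0 < x i)
    (hzero : ∀ i : Fin (n / 2), k ≤ (i : ℕ) → x i = 0)
    (δ : ℝ) (hδ0 : 0 < δ) (hδ : ∀ i : Fin (n / 2), (i : ℕ) < k → δ < x i)
    (y : Fin (n / 2) → ℝ) (hy : y = fun i : Fin (n / 2) => if (i : ℕ) < k then x i - δ else 0) :
    weylSO n y < weylSO n x := by
  have hy_le : ∀ i, y i ≤ x i := by
    intro i
    rw [hy]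
    dsimp only
    split_ifs with h
    · linarith
    · exact (hzero i (not_lt.mp h)).ge
  have hy_nonneg : ∀ i, 0 ≤ y i := by
    intro i
    rw [hy]
    dsimp only
    split_ifs with h
    · linarith [hδ i h]
    · exact le_rfl
  have hdiff_nonneg : ∀ i j, i < j → 0 ≤ y i - y j := by
    intro i j hij
    have hij' : (i : ℕ) < j := hij
    have hs := hsort i j hij.le
    have hi := hy_nonneg i
    rw [hy] at hi ⊢
    dsimp only at hi ⊢
    split_ifs at hi ⊢ <;> first | omega | linarith
  have hdiff_le : ∀ i j, i < j → y i - y j ≤ x i - x j := by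
    intro i j hij
    have hij' : (i : ℕ) < j := hij
    rw [hy]
    dsimp only
    split_ifs with hi hj hj
    · linarith
    · linarith [hzero j (not_lt.mp hj)]
    · omega
    · linarith [hzero i (not_lt.mp hi), hzero j (not_lt.mp hj)]
  have hden_diff : ∀ i j : Fin (n / 2), i < j → (0 : ℝ) < ((j : ℕ) : ℝ) - ((i : ℕ) : ℝ) :=
    fun i j hij => sub_pos.mpr (Nat.cast_lt.mpr hij)
  have hden_sum : ∀ i j : Fin (n / 2), (i : ℕ) + 1 + (j + 1) < n →
      (0 : ℝ) < (n : ℝ) - (((i : ℕ) : ℝ) + 1) - (((j : ℕ) : ℝ) + 1) := by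
    intro i j h
    have : (((i : ℕ) : ℝ) + 1) + (((j : ℕ) : ℝ) + 1) < n := by exact_mod_cast h
    linarith
  let i₀ : Fin (n / 2) := ⟨0, by omega⟩
  have hy_lt : y i₀ < x i₀ := by
    have : (i₀ : ℕ) < k := hk1
    simp only [hy, if_pos this]
    linarith
  -- positivity and monotonicity of the individual factors
  have hD_pos : ∀ i j : Fin (n / 2), i < j →
      0 < (y i - y j - (((i : ℕ) : ℝ) + 1) + (((j : ℕ) : ℝ) + 1)) /
        (((j : ℕ) : ℝ) - ((i : ℕ) : ℝ)) := fun i j hij =>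
    div_pos (by linarith [hdiff_nonneg i j hij, hden_diff i j hij]) (hden_diff i j hij)
  have hD_le : ∀ i j : Fin (n / 2), i < j →
      (y i - y j - (((i : ℕ) : ℝ) + 1) + (((j : ℕ) : ℝ) + 1)) /
        (((j : ℕ) : ℝ) - ((i : ℕ) : ℝ)) ≤
      (x i - x j - (((i : ℕ) : ℝ) + 1) + (((j : ℕ) : ℝ) + 1)) /
        (((j : ℕ) : ℝ) - ((i : ℕ) : ℝ)) := fun i j hij =>
    div_le_div_of_nonneg_right (by linarith [hdiff_le i j hij]) (hden_diff i j hij).le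
  have hS_pos : ∀ i j : Fin (n / 2), (i : ℕ) + 1 + (j + 1) < n →
      0 < (y i + y j + (n : ℝ) - (((i : ℕ) : ℝ) + 1) - (((j : ℕ) : ℝ) + 1)) /
        ((n : ℝ) - (((i : ℕ) : ℝ) + 1) - (((j : ℕ) : ℝ) + 1)) := fun i j h =>
    div_pos (by linarith [hy_nonneg i, hy_nonneg j, hden_sum i j h]) (hden_sum i j h)
  have hS_le : ∀ i j : Fin (n / 2), (i : ℕ) + 1 + (j + 1) < n →
      (y i + y j + (n : ℝ) - (((i : ℕ) : ℝ) + 1) - (((j : ℕ) : ℝ) + 1)) /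
        ((n : ℝ) - (((i : ℕ) : ℝ) + 1) - (((j : ℕ) : ℝ) + 1)) ≤
      (x i + x j + (n : ℝ) - (((i : ℕ) : ℝ) + 1) - (((j : ℕ) : ℝ) + 1)) /
        ((n : ℝ) - (((i : ℕ) : ℝ) + 1) - (((j : ℕ) : ℝ) + 1)) := fun i j h =>
    div_le_div_of_nonneg_right (by linarith [hy_le i, hy_le j]) (hden_sum i j h).le
  have hS_lt : ∀ j : Fin (n / 2), (i₀ : ℕ) + 1 + (j + 1) < n →
      (y i₀ + y j + (n : ℝ) - (((i₀ : ℕ) : ℝ) + 1) - (((j : ℕ) : ℝ) + 1)) /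
        ((n : ℝ) - (((i₀ : ℕ) : ℝ) + 1) - (((j : ℕ) : ℝ) + 1)) <
      (x i₀ + x j + (n : ℝ) - (((i₀ : ℕ) : ℝ) + 1) - (((j : ℕ) : ℝ) + 1)) /
        ((n : ℝ) - (((i₀ : ℕ) : ℝ) + 1) - (((j : ℕ) : ℝ) + 1)) := fun j h =>
    div_lt_div_of_pos_right (by linarith [hy_le j]) (hden_sum i₀ j h)
  unfold weylSO
  split_ifs with hodd
  · have hlt : ∀ i j : Fin (n / 2), (i : ℕ) + 1 + (j + 1) < n := by omega
    refine mul_lt_mul' (Finset.prod_le_prod ?_ ?_) (prod_prod_lt_prod_prod ?_ ?_ ?_) ?_ ?_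
    · refine fun i _ => Finset.prod_nonneg fun j _ => ?_
      split_ifs with hij
      exacts [(hD_pos i j hij).le, zero_le_one]
    · refine fun i _ => Finset.prod_le_prod (fun j _ => ?_) fun j _ => ?_ <;> split_ifs with hij
      exacts [(hD_pos i j hij).le, zero_le_one, hD_le i j hij, le_rfl]
    · intro i j
      split_ifs
      exacts [hS_pos i j (hlt i j), one_pos]
    · intro i j
      split_ifs
      exacts [hS_le i j (hlt i j), le_rfl]
    · refine ⟨i₀, i₀, ?_⟩
      simpa only [le_refl, if_true] using hS_lt i₀ (hlt i₀ i₀)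
    · refine Finset.prod_nonneg fun i _ => Finset.prod_nonneg fun j _ => ?_
      split_ifs
      exacts [(hS_pos i j (hlt i j)).le, zero_le_one]
    · refine Finset.prod_pos fun i _ => Finset.prod_pos fun j _ => ?_
      split_ifs with hij
      exacts [(hD_pos i j hij).trans_le (hD_le i j hij), one_pos]
  · have hlt : ∀ i j : Fin (n / 2), i < j → (i : ℕ) + 1 + (j + 1) < n := by omega
    refine prod_prod_lt_prod_prod ?_ ?_ ?_
    · intro i j
      split_ifs with hij
      exacts [mul_pos (hD_pos i j hij) (hS_pos i j (hlt i j hij)), one_pos]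
    · intro i j
      split_ifs with hij
      · exact mul_le_mul (hD_le i j hij) (hS_le i j (hlt i j hij)) (hS_pos i j (hlt i j hij)).le
          ((hD_pos i j hij).trans_le (hD_le i j hij)).le
      · exact le_rfl
    · let j₀ : Fin (n / 2) := ⟨1, by omega⟩
      have hij : i₀ < j₀ := Nat.zero_lt_one
      refine ⟨i₀, j₀, ?_⟩
      rw [if_pos hij, if_pos hij]
      exact mul_lt_mul' (hD_le i₀ j₀ hij) (hS_lt j₀ (hlt i₀ j₀ hij))
        (hS_pos i₀ j₀ (hlt i₀ j₀ hij)).le ((hD_pos i₀ j₀ hij).trans_le (hD_le i₀ j₀ hij))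
end
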